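/- Let G be a finite simple graph in which every vertex has degree at least 3, containing the path configuration with the additional assumption that |N(w1) ∩ P| ≥ |N(w2) ∩ P|. Suppose that every feedback vertex set S_Q of Q satisfies at least one of: (1) |S_Q| ≥ 3; (2) Q − S_Q contains a path from u to v; (3) w1 ∈ S_Q; (4) w2 ∈ S_Q. Then for every integer k ≥ 1, G has a feedback vertex set of size at most k if and only if G − w1 has a feedback vertex set of size at most k − 1. (Correctness of Rule 14, stated for simple graphs.) -/

import Mathlib

/-- A set `S` is a feedback vertex set of `G` if the subgraph induced on the
complement of `S` is acyclic. `HasFVS G k` means `G` has a feedback vertex set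
of size at most `k`. -/
def HasFVS {V : Type*} (G : SimpleGraph V) (k : ℕ) : Prop :=
  ∃ S : Set V, S.ncard ≤ k ∧ (G.induce Sᶜ).IsAcyclic

/-- `ReachIn G W p q`: in the subgraph of `G` induced on `W`, vertex `p` can reach `q`
(in particular both lie in `W`). -/
def ReachIn {V : Type*} (G : SimpleGraph V) (W : Set V) (p q : V) : Prop :=
  ∃ (hp : p ∈ W) (hq : q ∈ W), (G.induce W).Reachable ⟨p, hp⟩ ⟨q, hq⟩

/-- A gamma configuration in `G`: distinct vertices `u, v, w, x` such that `u` has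
exactly the three neighbors `v, w, x` and `v` is adjacent to both `w` and `x`. -/
def HasGammaConfig {V : Type*} (G : SimpleGraph V) : Prop :=
  ∃ u v w x : V, u ≠ v ∧ u ≠ w ∧ u ≠ x ∧ v ≠ w ∧ v ≠ x ∧ w ≠ x ∧
    G.neighborSet u = {v, w, x} ∧ G.Adj v w ∧ G.Adj v x

/-- The path configuration: `u0, u, x1, x2, x3, v, v0` form an induced path in this
order, `w1, w2` are two further distinct vertices not among these seven, every
neighbor of a vertex of `P = {u, x1, x2, x3, v}` lying outside `P` belongs to
`{u0, v0, w1, w2}`, and each of `w1, w2` has at least one neighbor in `P`. -/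
structure PathConfig {V : Type*} (G : SimpleGraph V)
    (u0 u x1 x2 x3 v v0 w1 w2 : V) : Prop where
  nodup : [u0, u, x1, x2, x3, v, v0, w1, w2].Nodup
  adj1 : G.Adj u0 u
  adj2 : G.Adj u x1
  adj3 : G.Adj x1 x2
  adj4 : G.Adj x2 x3
  adj5 : G.Adj x3 v
  adj6 : G.Adj v v0
  na1 : ¬ G.Adj u0 x1
  na2 : ¬ G.Adj u0 x2
  na3 : ¬ G.Adj u0 x3
  na4 : ¬ G.Adj u0 v
  na5 : ¬ G.Adj u0 v0
  na6 : ¬ G.Adj u x2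
  na7 : ¬ G.Adj u x3
  na8 : ¬ G.Adj u v
  na9 : ¬ G.Adj u v0
  na10 : ¬ G.Adj x1 x3
  na11 : ¬ G.Adj x1 v
  na12 : ¬ G.Adj x1 v0
  na13 : ¬ G.Adj x2 v
  na14 : ¬ G.Adj x2 v0
  na15 : ¬ G.Adj x3 v0
  closed : ∀ p ∈ ({u, x1, x2, x3, v} : Set V), ∀ y : V, G.Adj p y →
    y ∉ ({u, x1, x2, x3, v} : Set V) → y ∈ ({u0, v0, w1, w2} : Set V)
  w1nb : ∃ p ∈ ({u, x1, x2, x3, v} : Set V), G.Adj w1 p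
  w2nb : ∃ p ∈ ({u, x1, x2, x3, v} : Set V), G.Adj w2 p

namespace SimpleGraph

variable {V : Type*} {G : SimpleGraph V}

theorem isAcyclic_induce_iff {W : Set V} :
    (G.induce W).IsAcyclic ↔
      ∀ (x : V) (c : G.Walk x x), c.IsCycle → ¬ ∀ y ∈ c.support, y ∈ W := by
  constructor
  · intro h x c hc hW
    refine h (c.induce W hW) (Walk.IsCycle.of_map (f := (Embedding.induce W).toHom) ?_)
    rwa [Walk.map_induce]
  · intro h x c hc
    refine h _ (c.map (Embedding.induce W).toHom)
      (hc.map (f := (Embedding.induce W).toHom) (Embedding.induce (G := G) W).injective) ?_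
    simp only [Walk.support_map, List.mem_map]
    rintro _ ⟨y, -, rfl⟩
    exact y.2

theorem IsAcyclic.induce_mono {W W' : Set V} (h : (G.induce W').IsAcyclic) (hW : W ⊆ W') :
    (G.induce W).IsAcyclic :=
  h.embedding (induceHomOfLE G hW)

theorem Walk.apply_iff_of_support_subset {W : Set V} {f : V → Prop}
    (hf : ∀ x ∈ W, ∀ y ∈ W, G.Adj x y → (f x ↔ f y)) {x y : V} (p : G.Walk x y)
    (hp : ∀ z ∈ p.support, z ∈ W) : f x ↔ f y := by
  induction p with
  | nil => rfl
  | cons h p ih =>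
    simp only [Walk.support_cons, List.mem_cons, forall_eq_or_imp] at hp
    exact (hf _ hp.1 _ (hp.2 _ p.start_mem_support) h).trans (ih hp.2)

/-- Adding a vertex preserves acyclicity if any two of its neighbors lie in different
components. -/
theorem IsAcyclic.induce_insert {W : Set V} {z : V} (h : (G.induce W).IsAcyclic)
    (hz : ∀ a ∈ W, ∀ b ∈ W, G.Adj z a → G.Adj z b → a ≠ b →
      ∃ f : V → Prop, (∀ x ∈ W, ∀ y ∈ W, G.Adj x y → (f x ↔ f y)) ∧ ¬ (f a ↔ f b)) :
    (G.induce (insert z W)).IsAcyclic := by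
  classical
  rw [isAcyclic_induce_iff] at h ⊢
  intro x c hc hW
  by_cases hzc : z ∈ c.support
  · have hW' : ∀ y ∈ (c.rotate z hzc).support, y ∈ insert z W := by
      intro y hy
      exact hW y (by simpa using hy)
    replace hc := hc.rotate hzc
    generalize c.rotate z hzc = d at hc hW'
    have hnil := hc.not_nil
    have hlen := hc.three_le_length
    have htnil : ¬ d.tail.Nil := by
      rw [← Walk.length_eq_zero_iff]
      have := Walk.length_tail_add_one hnil
      omega
    have hpath : d.tail.support.Nodup := hc.isPath_tail.support_nodup
    have hsup : d.tail.support = d.tail.dropLast.support ++ [z] := by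
      rw [Walk.support_dropLast htnil, Walk.dropLast_support_concat]
    rw [hsup, List.nodup_append] at hpath
    have hin : ∀ y ∈ d.tail.dropLast.support, y ∈ W := by
      intro y hy
      have hyz : y ≠ z := hpath.2.2 y hy z (by simp)
      have hy' : y ∈ d.support := by
        have : y ∈ d.tail.support := by rw [hsup]; simp [hy]
        rw [Walk.support_tail_of_not_nil _ hnil] at this
        exact List.mem_of_mem_tail this
      exact (hW' y hy').resolve_left hyz
    have hpen : d.tail.penultimate = d.penultimate := by
      simp only [Walk.penultimate, Walk.getVert_tail]
      congr 1
      have := Walk.length_tail_add_one hnil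
      omega
    have hne := hc.snd_ne_penultimate
    rw [← hpen] at hne
    obtain ⟨f, hf, hab⟩ := hz d.snd (hin _ (Walk.start_mem_support _)) d.tail.penultimate
      (hin _ (Walk.end_mem_support _)) (d.adj_snd hnil)
      (d.tail.adj_penultimate htnil).symm hne
    exact hab (d.tail.dropLast.apply_iff_of_support_subset hf hin)
  · refine h x c hc fun y hy => (hW y hy).resolve_left ?_
    rintro rfl
    exact hzc hy

theorem IsAcyclic.induce_insert_of_subsingleton {W : Set V} {z : V} (b : V)
    (h : (G.induce W).IsAcyclic) (hz : ∀ a ∈ W, G.Adj z a → a = b) :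
    (G.induce (insert z W)).IsAcyclic :=
  h.induce_insert fun _ ha _ hb hza hzb hab => (hab ((hz _ ha hza).trans (hz _ hb hzb).symm)).elim

theorem IsAcyclic.not_adj_ends_of_isPath {W : Set V} (h : (G.induce W).IsAcyclic) {w x y : V}
    (p : G.Walk x y) (hp : p.IsPath) (hW : ∀ z ∈ p.support, z ∈ W) (hw : w ∈ W)
    (hwp : w ∉ p.support) (hxy : x ≠ y) (hx : G.Adj w x) : ¬ G.Adj w y := by
  intro hy
  refine isAcyclic_induce_iff.1 h w (.cons hx (p.concat hy.symm)) ?_ ?_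
  · rw [Walk.cons_isCycle_iff, Walk.edges_concat]
    refine ⟨hp.concat hwp _, ?_⟩
    simp only [List.concat_eq_append, List.mem_append, List.mem_singleton, not_or]
    refine ⟨fun hmem => hwp (p.fst_mem_support_of_mem_edges hmem), ?_⟩
    rw [Sym2.eq_swap]
    simp only [Sym2.eq_iff, and_true, not_or, not_and]
    exact ⟨hxy, fun hxw => (hx.ne hxw.symm).elim⟩
  · simp only [Walk.support_cons, Walk.support_concat, List.mem_cons, List.mem_append,
      List.not_mem_nil, or_false]
    rintro z (rfl | hz | rfl)
    exacts [hw, hW z hz, hw]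

theorem IsAcyclic.not_hexagon {Z : Set V} (hZ : (G.induce Z).IsAcyclic)
    {a b c d e f : V} (hnd : [a, b, c, d, e, f].Nodup)
    (hmem : ∀ x ∈ [a, b, c, d, e, f], x ∈ Z) (hab : G.Adj a b) (hbc : G.Adj b c)
    (hcd : G.Adj c d) (hde : G.Adj d e) (hef : G.Adj e f) : ¬ G.Adj f a := by
  simp only [List.nodup_cons, List.mem_cons, List.not_mem_nil, or_false, not_or,
    forall_eq_or_imp, forall_eq] at hnd hmem
  rw [G.adj_comm]
  apply hZ.not_adj_ends_of_isPath (.cons hbc (.cons hcd (.cons hde (.cons hef .nil)))) <;>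
    simp_all

end SimpleGraph

section ReachIn

variable {V : Type*} {G : SimpleGraph V}

theorem ReachIn.refl {W : Set V} {x : V} (hx : x ∈ W) : ReachIn G W x x :=
  ⟨hx, hx, .rfl⟩

theorem ReachIn.symm {W : Set V} {x y : V} (h : ReachIn G W x y) : ReachIn G W y x :=
  let ⟨hx, hy, hxy⟩ := h
  ⟨hy, hx, hxy.symm⟩

theorem ReachIn.head {W : Set V} {x y z : V} (hx : x ∈ W) (h : G.Adj x y)
    (hyz : ReachIn G W y z) : ReachIn G W x z := by
  obtain ⟨hy, hz, hr⟩ := hyz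
  have hxy : (G.induce W).Adj ⟨x, hx⟩ ⟨y, hy⟩ := h
  exact ⟨hx, hz, hxy.reachable.trans hr⟩

/-- Two disjoint connected pieces of an acyclic induced subgraph are joined by at most one
edge. -/
theorem SimpleGraph.IsAcyclic.not_reachIn_of_disjoint {Z R Q : Set V}
    (h : (G.induce Z).IsAcyclic) (hR : R ⊆ Z) (hQ : Q ⊆ Z) (hRQ : Disjoint R Q) {a b c d : V}
    (hac : G.Adj a c) (hbd : G.Adj b d) (hne : a ≠ b) (hab : ReachIn G R a b) :
    ¬ ReachIn G Q c d := by
  rintro ⟨hc, hd, hcd⟩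
  obtain ⟨ha, hb, hab⟩ := hab
  rw [Set.disjoint_left] at hRQ
  have hbr := SimpleGraph.isAcyclic_iff_forall_adj_isBridge.1 h
    (v := ⟨a, hR ha⟩) (w := ⟨c, hQ hc⟩) hac
  rw [SimpleGraph.isBridge_iff] at hbr
  set H := (G.induce Z).deleteEdges {s(⟨a, hR ha⟩, ⟨c, hQ hc⟩)} with hH
  have h1 : H.Reachable ⟨a, hR ha⟩ ⟨b, hR hb⟩ := by
    refine hab.map (⟨fun x => ⟨x.1, hR x.2⟩, ?_⟩ : G.induce R →g H)
    intro x y hxy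
    have hx := hRQ x.2
    have hy := hRQ y.2
    simp only [hH, SimpleGraph.deleteEdges_adj, SimpleGraph.comap_adj, Set.mem_singleton_iff,
      Sym2.eq_iff, Subtype.mk.injEq]
    refine ⟨hxy, ?_⟩
    rintro (⟨-, rfl⟩ | ⟨rfl, -⟩)
    exacts [hy hc, hx hc]
  have h2 : H.Reachable ⟨c, hQ hc⟩ ⟨d, hQ hd⟩ := by
    refine hcd.map (⟨fun x => ⟨x.1, hQ x.2⟩, ?_⟩ : G.induce Q →g H)
    intro x y hxy
    have hx := fun hx => hRQ hx x.2
    have hy := fun hy => hRQ hy y.2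
    simp only [hH, SimpleGraph.deleteEdges_adj, SimpleGraph.comap_adj, Set.mem_singleton_iff,
      Sym2.eq_iff, Subtype.mk.injEq]
    refine ⟨hxy, ?_⟩
    rintro (⟨rfl, -⟩ | ⟨-, rfl⟩)
    exacts [hx ha, hy ha]
  have h3 : H.Adj ⟨b, hR hb⟩ ⟨d, hQ hd⟩ := by
    simp only [hH, SimpleGraph.deleteEdges_adj, SimpleGraph.comap_adj, Set.mem_singleton_iff,
      Sym2.eq_iff, Subtype.mk.injEq]
    refine ⟨hbd, ?_⟩
    rintro (⟨rfl, -⟩ | ⟨rfl, -⟩)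
    exacts [hne rfl, hRQ hb hc]
  exact hbr ((h1.trans h3.reachable).trans h2.symm)

end ReachIn

theorem Set.ncard_inter_five {V : Type*} (A : Set V) [DecidablePred (· ∈ A)] {a b c d e : V}
    (h : [a, b, c, d, e].Nodup) :
    (A ∩ {a, b, c, d, e}).ncard = (if a ∈ A then 1 else 0) + (if b ∈ A then 1 else 0) +
      (if c ∈ A then 1 else 0) + (if d ∈ A then 1 else 0) + (if e ∈ A then 1 else 0) := by
  classical
  have hs : A ∩ {a, b, c, d, e} =
      (({a, b, c, d, e} : Finset V).filter (· ∈ A) : Finset V) := by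
    ext x; simp [and_comm]
  simp only [List.nodup_cons, List.mem_cons, List.not_mem_nil, or_false, not_or] at h
  obtain ⟨⟨h1, h2, h3, h4⟩, ⟨h5, h6, h7⟩, ⟨h8, h9⟩, h10, -⟩ := h
  rw [hs, Set.ncard_coe_finset, Finset.card_filter, Finset.sum_insert (by simp [*]),
    Finset.sum_insert (by simp [*]), Finset.sum_insert (by simp [*]),
    Finset.sum_insert (by simp [*]), Finset.sum_singleton]
  ring

theorem Set.ncard_inter_five_le_one {V : Type*} {A : Set V} {a b c d e : V}
    (h : [a, b, c, d, e].Nodup) (hA : (A ∩ {a, b, c, d, e}).ncard ≤ 1) :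
    (A ∩ {a, b, c, d, e}).ncard = 0 ∧ a ∉ A ∧ b ∉ A ∧ c ∉ A ∧ d ∉ A ∧ e ∉ A ∨
    (A ∩ {a, b, c, d, e}).ncard = 1 ∧
      (a ∈ A ∧ b ∉ A ∧ c ∉ A ∧ d ∉ A ∧ e ∉ A ∨ a ∉ A ∧ b ∈ A ∧ c ∉ A ∧ d ∉ A ∧ e ∉ A ∨
      a ∉ A ∧ b ∉ A ∧ c ∈ A ∧ d ∉ A ∧ e ∉ A ∨ a ∉ A ∧ b ∉ A ∧ c ∉ A ∧ d ∈ A ∧ e ∉ A ∨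
      a ∉ A ∧ b ∉ A ∧ c ∉ A ∧ d ∉ A ∧ e ∈ A) := by
  classical
  rw [Set.ncard_inter_five A h] at hA ⊢
  split_ifs at * <;> simp_all

theorem hasFVS_induce_compl_singleton_iff {V : Type*} [Finite V] {G : SimpleGraph V} {w : V}
    {k : ℕ} (hk : 1 ≤ k) :
    HasFVS (G.induce ({w}ᶜ : Set V)) (k - 1) ↔
      ∃ S : Set V, w ∈ S ∧ S.ncard ≤ k ∧ (G.induce Sᶜ).IsAcyclic := by
  constructor
  · rintro ⟨S, hS, hac⟩
    refine ⟨insert w (Subtype.val '' S), Set.mem_insert _ _, ?_, ?_⟩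
    · have h1 := Set.ncard_insert_le w (Subtype.val '' S)
      rw [Set.ncard_image_of_injective S Subtype.val_injective] at h1
      omega
    · refine hac.comap ⟨fun x => ⟨⟨x.1, fun h => x.2 (Or.inl h)⟩,
        fun h => x.2 (Or.inr ⟨_, h, rfl⟩)⟩, fun h => h⟩ ?_
      intro x y hxy
      exact Subtype.ext (congrArg (fun z => z.1.1) hxy)
  · rintro ⟨S, hw, hS, hac⟩
    refine ⟨Subtype.val ⁻¹' S, ?_, ?_⟩
    · have h1 : (Subtype.val ⁻¹' S : Set ({w}ᶜ : Set V)).ncard = (S \ {w}).ncard := by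
        rw [← Set.ncard_image_of_injective _ Subtype.val_injective,
          Subtype.image_preimage_coe, Set.inter_comm]
        rfl
      have h2 := Set.ncard_sdiff_singleton_add_one hw
      omega
    · refine hac.comap ⟨fun x => ⟨x.1.1, x.2⟩, fun h => h⟩ ?_
      intro x y hxy
      exact Subtype.ext (Subtype.ext (congrArg (fun z => z.1) hxy))

namespace PathConfig

variable {V : Type*} {G : SimpleGraph V} {u0 u x1 x2 x3 v v0 w1 w2 : V}

theorem nodup_path (hpc : PathConfig G u0 u x1 x2 x3 v v0 w1 w2) :
    [u, x1, x2, x3, v].Nodup := by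
  have := hpc.nodup
  simp only [List.nodup_cons, List.mem_cons, List.not_mem_nil, or_false, not_or] at this ⊢
  tauto

theorem adj_cases (hpc : PathConfig G u0 u x1 x2 x3 v v0 w1 w2) (y : V) :
    (G.Adj u y → y = u0 ∨ y = x1 ∨ y = w1 ∨ y = w2) ∧
    (G.Adj x1 y → y = u ∨ y = x2 ∨ y = w1 ∨ y = w2) ∧
    (G.Adj x2 y → y = x1 ∨ y = x3 ∨ y = w1 ∨ y = w2) ∧
    (G.Adj x3 y → y = x2 ∨ y = v ∨ y = w1 ∨ y = w2) ∧
    (G.Adj v y → y = x3 ∨ y = v0 ∨ y = w1 ∨ y = w2) := by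
  have key : ∀ p ∈ ({u, x1, x2, x3, v} : Set V), G.Adj p y →
      y = u ∨ y = x1 ∨ y = x2 ∨ y = x3 ∨ y = v ∨ y = u0 ∨ y = v0 ∨ y = w1 ∨ y = w2 := by
    intro p hp h
    by_cases hy : y ∈ ({u, x1, x2, x3, v} : Set V)
    · simp only [Set.mem_insert_iff, Set.mem_singleton_iff] at hy
      tauto
    · have := hpc.closed p hp y h hy
      simp only [Set.mem_insert_iff, Set.mem_singleton_iff] at this
      tauto
  obtain ⟨-, -, -, -, -, -, -, n1, n2, n3, n4, n5, n6, n7, n8, n9, n10, n11, n12, n13,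
    n14, n15, -, -, -⟩ := hpc
  simp only [Set.mem_insert_iff, Set.mem_singleton_iff, forall_eq_or_imp, forall_eq] at key
  obtain ⟨k1, k2, k3, k4, k5⟩ := key
  refine ⟨fun h => ?_, fun h => ?_, fun h => ?_, fun h => ?_, fun h => ?_⟩
  · rcases k1 h with rfl | rfl | rfl | rfl | rfl | rfl | rfl | rfl | rfl <;>
      simp_all [G.adj_comm]
  · rcases k2 h with rfl | rfl | rfl | rfl | rfl | rfl | rfl | rfl | rfl <;>
      simp_all [G.adj_comm]
  · rcases k3 h with rfl | rfl | rfl | rfl | rfl | rfl | rfl | rfl | rfl <;>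
      simp_all [G.adj_comm]
  · rcases k4 h with rfl | rfl | rfl | rfl | rfl | rfl | rfl | rfl | rfl <;>
      simp_all [G.adj_comm]
  · rcases k5 h with rfl | rfl | rfl | rfl | rfl | rfl | rfl | rfl | rfl <;>
      simp_all [G.adj_comm]

/-- Attaching the path without its first vertex to an acyclic graph keeps it acyclic, and so
does attaching the whole path unless `u0` and `v0` are already connected. -/
theorem isAcyclic_induce_insert (hpc : PathConfig G u0 u x1 x2 x3 v v0 w1 w2) {W : Set V}
    (hW : (G.induce W).IsAcyclic) (hWP : ∀ p ∈ ({u, x1, x2, x3, v} : Set V), p ∉ W)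
    (hw1 : w1 ∉ W) (hw2 : w2 ∉ W) :
    (G.induce (insert x1 (insert x2 (insert x3 (insert v W))))).IsAcyclic ∧
    (¬ ReachIn G W v0 u0 →
      (G.induce (insert u (insert x1 (insert x2 (insert x3 (insert v W)))))).IsAcyclic) := by
  have hadj := hpc.adj_cases
  have hnd := hpc.nodup
  simp only [Set.mem_insert_iff, Set.mem_singleton_iff, forall_eq_or_imp, forall_eq] at hWP
  simp only [List.nodup_cons, List.mem_cons, List.not_mem_nil, or_false, not_or] at hnd
  have key : (G.induce (insert x1 (insert x2 (insert x3 (insert v W))))).IsAcyclic := by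
    refine .induce_insert_of_subsingleton x2 (.induce_insert_of_subsingleton x3
      (.induce_insert_of_subsingleton v (.induce_insert_of_subsingleton v0 hW ?_) ?_) ?_) ?_
    all_goals
      intro a ha hza
      try simp only [Set.mem_insert_iff] at ha
      have := hadj a
      clear hadj hpc
      grind
  refine ⟨key, fun hr => key.induce_insert ?_⟩
  have hcomp : ∀ x ∈ insert x1 (insert x2 (insert x3 (insert v W))),
      ∀ y ∈ insert x1 (insert x2 (insert x3 (insert v W))), G.Adj x y →
      ((x = x1 ∨ x = x2 ∨ x = x3 ∨ x = v) ∨ ReachIn G W v0 x) →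
      ((y = x1 ∨ y = x2 ∨ y = x3 ∨ y = v) ∨ ReachIn G W v0 y) := by
    have hstep : ∀ x y, y ∈ W → G.Adj x y → ReachIn G W v0 x → ReachIn G W v0 y := by
      rintro x y hy hxy ⟨h0, hx, h⟩
      have : (G.induce W).Adj ⟨x, hx⟩ ⟨y, hy⟩ := hxy
      exact ⟨h0, hy, h.trans this.reachable⟩
    have hrefl : v0 ∈ W → ReachIn G W v0 v0 := ReachIn.refl
    simp only [Set.mem_insert_iff]
    intro x hx y hy hxy h
    have h1 := hadj y
    have h2 := hstep x y
    have h3 : ReachIn G W v0 x → x ∈ W := fun h => h.2.1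
    clear hstep hadj
    rcases h with (rfl | rfl | rfl | rfl) | h <;> grind
  have hfx1 : ∀ f : V → Prop, f x1 → ¬ f u0 → ∀ a b, a = u0 ∨ a = x1 → b = u0 ∨ b = x1 →
      a ≠ b → ¬ (f a ↔ f b) := by
    rintro f h1 h0 a b (rfl | rfl) (rfl | rfl) hab <;> simp_all
  have hend : ∀ a ∈ insert x1 (insert x2 (insert x3 (insert v W))), G.Adj u a →
      a = u0 ∨ a = x1 := by
    simp only [Set.mem_insert_iff]
    intro a ha hua
    have := (hadj a).1 hua
    clear hadj hpc hcomp
    grind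
  intro a ha b hb hua hub hab
  refine ⟨fun x => (x = x1 ∨ x = x2 ∨ x = x3 ∨ x = v) ∨ ReachIn G W v0 x,
    fun x hx y hy hxy => ⟨hcomp x hx y hy hxy, hcomp y hy x hx hxy.symm⟩,
    hfx1 (fun x => (x = x1 ∨ x = x2 ∨ x = x3 ∨ x = v) ∨ ReachIn G W v0 x) ?_ ?_ a b
      (hend a ha hua) (hend b hb hub) hab⟩
  · exact Or.inl (Or.inl rfl)
  tauto

/-- An acyclic set containing a common neighbor `w` of two path vertices misses some vertex
between them. -/
theorem not_adj_pair (hpc : PathConfig G u0 u x1 x2 x3 v v0 w1 w2) {Z : Set V} {w : V}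
    (hZ : (G.induce Z).IsAcyclic) (hw : w ∈ Z) (hwP : w ∉ ({u, x1, x2, x3, v} : Set V)) :
    (u ∈ Z → x1 ∈ Z → G.Adj w u → ¬ G.Adj w x1) ∧
    (u ∈ Z → x1 ∈ Z → x2 ∈ Z → G.Adj w u → ¬ G.Adj w x2) ∧
    (u ∈ Z → x1 ∈ Z → x2 ∈ Z → x3 ∈ Z → G.Adj w u → ¬ G.Adj w x3) ∧
    (u ∈ Z → x1 ∈ Z → x2 ∈ Z → x3 ∈ Z → v ∈ Z → G.Adj w u → ¬ G.Adj w v) ∧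
    (x1 ∈ Z → x2 ∈ Z → G.Adj w x1 → ¬ G.Adj w x2) ∧
    (x1 ∈ Z → x2 ∈ Z → x3 ∈ Z → G.Adj w x1 → ¬ G.Adj w x3) ∧
    (x1 ∈ Z → x2 ∈ Z → x3 ∈ Z → v ∈ Z → G.Adj w x1 → ¬ G.Adj w v) ∧
    (x2 ∈ Z → x3 ∈ Z → G.Adj w x2 → ¬ G.Adj w x3) ∧
    (x2 ∈ Z → x3 ∈ Z → v ∈ Z → G.Adj w x2 → ¬ G.Adj w v) ∧
    (x3 ∈ Z → v ∈ Z → G.Adj w x3 → ¬ G.Adj w v) := by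
  have hnd := hpc.nodup_path
  obtain ⟨-, -, a2, a3, a4, a5, -⟩ := hpc
  simp only [List.nodup_cons, List.mem_cons, List.not_mem_nil, or_false, not_or] at hnd
  simp only [Set.mem_insert_iff, Set.mem_singleton_iff, not_or] at hwP
  refine ⟨?_, ?_, ?_, ?_, ?_, ?_, ?_, ?_, ?_, ?_⟩ <;> intros
  · apply hZ.not_adj_ends_of_isPath (.cons a2 .nil) <;> simp [*]
  · apply hZ.not_adj_ends_of_isPath (.cons a2 (.cons a3 .nil)) <;> simp [*]
  · apply hZ.not_adj_ends_of_isPath (.cons a2 (.cons a3 (.cons a4 .nil))) <;> simp [*]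
  · apply hZ.not_adj_ends_of_isPath (.cons a2 (.cons a3 (.cons a4 (.cons a5 .nil)))) <;> simp [*]
  · apply hZ.not_adj_ends_of_isPath (.cons a3 .nil) <;> simp [*]
  · apply hZ.not_adj_ends_of_isPath (.cons a3 (.cons a4 .nil)) <;> simp [*]
  · apply hZ.not_adj_ends_of_isPath (.cons a3 (.cons a4 (.cons a5 .nil))) <;> simp [*]
  · apply hZ.not_adj_ends_of_isPath (.cons a4 .nil) <;> simp [*]
  · apply hZ.not_adj_ends_of_isPath (.cons a4 (.cons a5 .nil)) <;> simp [*]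
  · apply hZ.not_adj_ends_of_isPath (.cons a5 .nil) <;> simp [*]

theorem adj_w1_or_w2 [Finite V] (hpc : PathConfig G u0 u x1 x2 x3 v v0 w1 w2)
    (hdeg3 : ∀ z : V, 3 ≤ (G.neighborSet z).ncard) :
    ∀ p ∈ ({u, x1, x2, x3, v} : Set V), G.Adj w1 p ∨ G.Adj w2 p := by
  have key : ∀ p ∈ ({u, x1, x2, x3, v} : Set V), ∀ a b : V,
      (∀ y, G.Adj p y → y ≠ w1 → y ≠ w2 → y = a ∨ y = b) → G.Adj w1 p ∨ G.Adj w2 p := by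
    intro p _ a b hab
    by_contra! h
    have hsub : G.neighborSet p ⊆ {a, b} := by
      intro y hy
      refine hab y hy ?_ ?_ <;> rintro rfl
      exacts [h.1 hy.symm, h.2 hy.symm]
    have h1 := Set.ncard_le_ncard hsub
    have h2 := Set.ncard_insert_le a {b}
    rw [Set.ncard_singleton] at h2
    have := hdeg3 p
    omega
  have hadj := hpc.adj_cases
  simp only [Set.mem_insert_iff, Set.mem_singleton_iff, forall_eq_or_imp, forall_eq] at key ⊢
  obtain ⟨k1, k2, k3, k4, k5⟩ := key
  refine ⟨k1 u0 x1 ?_, k2 u x2 ?_, k3 x1 x3 ?_, k4 x2 v ?_, k5 x3 v0 ?_⟩ <;> intro y hy hy1 hy2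
  · have := (hadj y).1 hy
    tauto
  · have := (hadj y).2.1 hy
    tauto
  · have := (hadj y).2.2.1 hy
    tauto
  · have := (hadj y).2.2.2.1 hy
    tauto
  · have := (hadj y).2.2.2.2 hy
    tauto

theorem three_le_card_adj_w1 [Finite V] [DecidableRel G.Adj]
    (hpc : PathConfig G u0 u x1 x2 x3 v v0 w1 w2)
    (hdeg3 : ∀ z : V, 3 ≤ (G.neighborSet z).ncard)
    (hw12 : (G.neighborSet w2 ∩ {u, x1, x2, x3, v}).ncard ≤
      (G.neighborSet w1 ∩ {u, x1, x2, x3, v}).ncard) :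
    3 ≤ (if G.Adj w1 u then 1 else 0) + (if G.Adj w1 x1 then 1 else 0) +
      (if G.Adj w1 x2 then 1 else 0) + (if G.Adj w1 x3 then 1 else 0) +
      (if G.Adj w1 v then 1 else 0) := by
  classical
  rw [Set.ncard_inter_five _ hpc.nodup_path, Set.ncard_inter_five _ hpc.nodup_path] at hw12
  simp only [SimpleGraph.mem_neighborSet] at hw12
  have key : ∀ p ∈ ({u, x1, x2, x3, v} : Set V),
      1 ≤ (if G.Adj w1 p then 1 else 0) + (if G.Adj w2 p then 1 else 0) := by
    intro p hp
    rcases hpc.adj_w1_or_w2 hdeg3 p hp with h | h <;> simp [h]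
  simp only [Set.mem_insert_iff, Set.mem_singleton_iff, forall_eq_or_imp, forall_eq] at key
  convert (show 3 ≤ _ from ?_) using 1
  omega

theorem w1_notMem_path (hpc : PathConfig G u0 u x1 x2 x3 v v0 w1 w2) :
    w1 ∉ ({u, x1, x2, x3, v} : Set V) := by
  have := hpc.nodup
  simp only [List.nodup_cons, List.mem_cons, List.not_mem_nil, or_false, not_or] at this
  simp only [Set.mem_insert_iff, Set.mem_singleton_iff, not_or]
  tauto

theorem w2_notMem_path (hpc : PathConfig G u0 u x1 x2 x3 v v0 w1 w2) :
    w2 ∉ ({u, x1, x2, x3, v} : Set V) := by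
  have := hpc.nodup
  simp only [List.nodup_cons, List.mem_cons, List.not_mem_nil, or_false, not_or] at this
  simp only [Set.mem_insert_iff, Set.mem_singleton_iff, not_or]
  tauto

/-- A feedback vertex set avoiding `w1` and `w2` contains at least two path vertices. -/
theorem one_lt_ncard_compl_inter [Finite V] (hpc : PathConfig G u0 u x1 x2 x3 v v0 w1 w2)
    (hdeg3 : ∀ z : V, 3 ≤ (G.neighborSet z).ncard) {Z : Set V} (hZ : (G.induce Z).IsAcyclic)
    (hw1 : w1 ∈ Z) (hw2 : w2 ∈ Z) : 1 < (Zᶜ ∩ {u, x1, x2, x3, v}).ncard := by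
  classical
  by_contra! hcard
  have pigeonhole : ∀ {A B C A' B' C' : Prop}, A ∨ A' → B ∨ B' → C ∨ C' → (A → ¬ B) →
      (A → ¬ C) → (B → ¬ C) → (A' → ¬ B') → (A' → ¬ C') → (B' → ¬ C') → False := by
    rintro A B C A' B' C' (h | h) (h' | h') (h'' | h'') <;> grind
  have matched : ∀ {A B A' B' : Prop}, A ∨ A' → B ∨ B' → (A → ¬ B) → (A' → ¬ B') →
      A ∧ B' ∨ B ∧ A' := by
    rintro A B A' B' (h | h) (h' | h') <;> grind
  obtain ⟨p01, p02, p03, p04, p12, p13, p14, p23, p24, p34⟩ :=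
    hpc.not_adj_pair hZ hw1 hpc.w1_notMem_path
  obtain ⟨q01, q02, q03, q04, q12, q13, q14, q23, q24, q34⟩ :=
    hpc.not_adj_pair hZ hw2 hpc.w2_notMem_path
  have hor := hpc.adj_w1_or_w2 hdeg3
  have hcases := Set.ncard_inter_five_le_one hpc.nodup_path hcard
  simp only [Set.mem_insert_iff, Set.mem_singleton_iff, forall_eq_or_imp, forall_eq] at hor
  simp only [Set.mem_compl_iff, not_not] at hcases
  obtain ⟨a0, a1, a2, a3, a4⟩ := hor
  rcases hcases with ⟨-, hu, h1, h2, h3, hv⟩ | ⟨-, ⟨hu, h1, h2, h3, hv⟩ | ⟨hu, h1, h2, h3, hv⟩ |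
    ⟨hu, h1, h2, h3, hv⟩ | ⟨hu, h1, h2, h3, hv⟩ | ⟨hu, h1, h2, h3, hv⟩⟩
  · exact pigeonhole a0 a1 a2 (p01 hu h1) (p02 hu h1 h2) (p12 h1 h2) (q01 hu h1) (q02 hu h1 h2)
      (q12 h1 h2)
  · exact pigeonhole a1 a2 a3 (p12 h1 h2) (p13 h1 h2 h3) (p23 h2 h3) (q12 h1 h2) (q13 h1 h2 h3)
      (q23 h2 h3)
  · exact pigeonhole a2 a3 a4 (p23 h2 h3) (p24 h2 h3 hv) (p34 h3 hv) (q23 h2 h3) (q24 h2 h3 hv)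
      (q34 h3 hv)
  · have hnd := hpc.nodup
    have hexagon : ∀ {a b c d : V}, [w1, a, b, w2, d, c].Nodup → a ∈ Z → b ∈ Z → c ∈ Z →
        d ∈ Z → G.Adj w1 a → G.Adj a b → G.Adj w2 b → G.Adj w1 c → G.Adj c d → ¬ G.Adj w2 d := by
      intro a b c d hn ha hb hc hd h1 h2 h3 h4 h5 h6
      exact hZ.not_hexagon hn (by simp [*]) h1 h2 h3.symm h6 h5.symm h4.symm
    have e1 := hpc.adj2
    have e2 := hpc.adj5
    simp only [List.nodup_cons, List.mem_cons, List.not_mem_nil, or_false, not_or] at hnd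
    rcases matched a0 a1 (p01 hu h1) (q01 hu h1) with ⟨b1, b2⟩ | ⟨b1, b2⟩ <;>
    rcases matched a3 a4 (p34 h3 hv) (q34 h3 hv) with ⟨c1, c2⟩ | ⟨c1, c2⟩
    · exact hexagon (by simp; grind) hu h1 h3 hv b1 e1 b2 c1 e2 c2
    · exact hexagon (by simp; grind) hu h1 hv h3 b1 e1 b2 c1 e2.symm c2
    · exact hexagon (by simp; grind) h1 hu h3 hv b1 e1.symm b2 c1 e2 c2
    · exact hexagon (by simp; grind) h1 hu hv h3 b1 e1.symm b2 c1 e2.symm c2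
  · exact pigeonhole a0 a1 a2 (p01 hu h1) (p02 hu h1 h2) (p12 h1 h2) (q01 hu h1) (q02 hu h1 h2)
      (q12 h1 h2)
  · exact pigeonhole a0 a1 a2 (p01 hu h1) (p02 hu h1 h2) (p12 h1 h2) (q01 hu h1) (q02 hu h1 h2)
      (q12 h1 h2)

/-- A feedback vertex set avoiding `w1` and containing at most one path vertex leaves `u` and
`v` connected within the path together with `w1` and `w2`. -/
theorem reachIn_of_ncard_le_one [Finite V] (hpc : PathConfig G u0 u x1 x2 x3 v v0 w1 w2)
    (hdeg3 : ∀ z : V, 3 ≤ (G.neighborSet z).ncard)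
    (hw12 : (G.neighborSet w2 ∩ {u, x1, x2, x3, v}).ncard ≤
      (G.neighborSet w1 ∩ {u, x1, x2, x3, v}).ncard) {Z : Set V} (hZ : (G.induce Z).IsAcyclic)
    (hw1 : w1 ∈ Z) (hcard : (Zᶜ ∩ {u, x1, x2, x3, v}).ncard ≤ 1) :
    1 ≤ (Zᶜ ∩ {u, x1, x2, x3, v}).ncard ∧
      ReachIn G ((({u, x1, x2, x3, v} : Set V) ∪ {w1, w2}) ∩ Z) u v := by
  classical
  have p1 := hpc.not_adj_pair hZ hw1 hpc.w1_notMem_path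
  have hthree := hpc.three_le_card_adj_w1 hdeg3 hw12
  set Q := (({u, x1, x2, x3, v} : Set V) ∪ {w1, w2}) ∩ Z with hQ
  have step : ∀ x y, x ∈ ({u, x1, x2, x3, v} : Set V) ∪ {w1, w2} → G.Adj x y → x ∈ Z →
      ReachIn G Q y v → ReachIn G Q x v := fun x y hx hxy hxZ => ReachIn.head ⟨hx, hxZ⟩ hxy
  have rv : v ∈ Z → ReachIn G Q v v := fun h => ReachIn.refl ⟨by simp, h⟩
  have r3 := step x3 v (by simp) hpc.adj5
  have r2 := step x2 x3 (by simp) hpc.adj4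
  have r1 := step x1 x2 (by simp) hpc.adj3
  have r0 := step u x1 (by simp) hpc.adj2
  have s1 := fun h : G.Adj w1 x1 => step w1 x1 (by simp) h hw1
  have s2 := fun h : G.Adj w1 x2 => step w1 x2 (by simp) h hw1
  have s3 := fun h : G.Adj w1 x3 => step w1 x3 (by simp) h hw1
  have sv := fun h : G.Adj w1 v => step w1 v (by simp) h hw1
  have t0 := fun h : G.Adj w1 u => step u w1 (by simp) h.symm
  have t1 := fun h : G.Adj w1 x1 => step x1 w1 (by simp) h.symm
  have t2 := fun h : G.Adj w1 x2 => step x2 w1 (by simp) h.symm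
  clear step hQ
  clear_value Q
  have hcases := Set.ncard_inter_five_le_one hpc.nodup_path hcard
  clear hpc hdeg3 hw12 hcard
  simp only [Set.mem_compl_iff, not_not] at hcases
  rcases hcases with ⟨-, hu, h1, h2, h3, hv⟩ | ⟨hc, ⟨hu, h1, h2, h3, hv⟩ | ⟨hu, h1, h2, h3, hv⟩ |
    ⟨hu, h1, h2, h3, hv⟩ | ⟨hu, h1, h2, h3, hv⟩ | ⟨hu, h1, h2, h3, hv⟩⟩ <;>
  simp only [hu, h1, h2, h3, hv, forall_const, false_imp_iff, and_true, true_and] at *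
  · grind
  · grind
  · grind
  · grind
  · grind
  · grind

/-- Exchanging the path vertices in a feedback vertex set for `w1`, `w2` and the first path
vertex gives a feedback vertex set. -/
theorem isAcyclic_induce_compl_insert (hpc : PathConfig G u0 u x1 x2 x3 v v0 w1 w2) {S : Set V}
    (hS : (G.induce Sᶜ).IsAcyclic) :
    (G.induce (insert u (S \ {u, x1, x2, x3, v} ∪ {w1, w2}))ᶜ).IsAcyclic := by
  refine (hpc.isAcyclic_induce_insert
    (W := (S ∪ ({u, x1, x2, x3, v} ∪ {w1, w2}))ᶜ) (hS.induce_mono ?_) ?_ ?_ ?_).1.induce_mono ?_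
  · exact Set.compl_subset_compl.2 Set.subset_union_left
  · exact fun p hp h => h (.inr (.inl hp))
  · simp
  · simp
  · intro y
    simp only [Set.mem_compl_iff, Set.mem_insert_iff, Set.mem_union, Set.mem_sdiff,
      Set.mem_singleton_iff]
    tauto

/-- Exchanging the path vertices in a feedback vertex set for `w1` and `w2` gives a feedback
vertex set if the old one leaves `u` and `v` connected near the path. -/
theorem isAcyclic_induce_compl_of_reachIn (hpc : PathConfig G u0 u x1 x2 x3 v v0 w1 w2)
    {S : Set V} (hS : (G.induce Sᶜ).IsAcyclic)
    (hr : ReachIn G ((({u, x1, x2, x3, v} : Set V) ∪ {w1, w2}) ∩ Sᶜ) u v) :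
    (G.induce (S \ {u, x1, x2, x3, v} ∪ {w1, w2})ᶜ).IsAcyclic := by
  have hW : (S ∪ ({u, x1, x2, x3, v} ∪ {w1, w2}))ᶜ ⊆ Sᶜ :=
    Set.compl_subset_compl.2 Set.subset_union_left
  refine ((hpc.isAcyclic_induce_insert
    (W := (S ∪ ({u, x1, x2, x3, v} ∪ {w1, w2}))ᶜ) (hS.induce_mono hW) ?_ ?_ ?_).2
      fun hvu => ?_).induce_mono ?_
  · exact fun p hp h => h (.inr (.inl hp))
  · simp
  · simp
  · refine hS.not_reachIn_of_disjoint hW Set.inter_subset_right ?_ hpc.adj6.symm hpc.adj1 ?_ hvu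
      hr.symm
    · exact Set.disjoint_left.2 fun y hy hy' => hy (.inr hy'.1)
    · have := hpc.nodup
      simp only [List.nodup_cons, List.mem_cons, List.not_mem_nil, or_false, not_or] at this
      exact Ne.symm (by tauto)
  · intro y
    simp only [Set.mem_compl_iff, Set.mem_insert_iff, Set.mem_union, Set.mem_sdiff,
      Set.mem_singleton_iff]
    tauto

end PathConfig

/-- Correctness of Rule 14, stated for simple graphs. -/
theorem stmt_7 {V : Type*} [Fintype V]
    (G : SimpleGraph V)
    (hdeg3 : ∀ z : V, 3 ≤ (G.neighborSet z).ncard)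
    (u0 u x1 x2 x3 v v0 w1 w2 : V)
    (hpc : PathConfig G u0 u x1 x2 x3 v v0 w1 w2)
    (hw12 : (G.neighborSet w2 ∩ {u, x1, x2, x3, v}).ncard ≤
            (G.neighborSet w1 ∩ {u, x1, x2, x3, v}).ncard)
    (hSQ : ∀ S_Q : Set V, S_Q ⊆ ({u, x1, x2, x3, v} : Set V) ∪ {w1, w2} →
      (G.induce ((({u, x1, x2, x3, v} : Set V) ∪ {w1, w2}) \ S_Q)).IsAcyclic →
      3 ≤ S_Q.ncard ∨
      ReachIn G ((({u, x1, x2, x3, v} : Set V) ∪ {w1, w2}) \ S_Q) u v ∨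
      w1 ∈ S_Q ∨ w2 ∈ S_Q)
    (k : ℕ) (hk : 1 ≤ k) :
    HasFVS G k ↔ HasFVS (G.induce ({w1}ᶜ : Set V)) (k - 1) := by
  rw [hasFVS_induce_compl_singleton_iff hk]
  refine ⟨?_, fun ⟨S, _, hS⟩ => ⟨S, hS⟩⟩
  rintro ⟨S, hS, hac⟩
  by_cases hw1 : w1 ∈ S
  · exact ⟨S, hw1, hS, hac⟩
  have hcard := Set.ncard_inter_add_ncard_sdiff_eq_ncard S {u, x1, x2, x3, v}
  by_cases hw2 : w2 ∈ S
  · have hT : (S \ {u, x1, x2, x3, v}) ∪ {w1, w2} = insert w1 (S \ {u, x1, x2, x3, v}) := by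
      ext y
      have := hpc.w2_notMem_path
      simp only [Set.mem_union, Set.mem_insert_iff, Set.mem_singleton_iff, Set.mem_sdiff] at this ⊢
      constructor
      · rintro (h | rfl | rfl)
        exacts [Or.inr h, Or.inl rfl, Or.inr ⟨hw2, this⟩]
      · tauto
    have hTcard := Set.ncard_insert_le w1 (S \ {u, x1, x2, x3, v})
    rw [← hT] at hTcard
    by_cases hle : (S ∩ {u, x1, x2, x3, v}).ncard ≤ 1
    · obtain ⟨h1, hr⟩ := hpc.reachIn_of_ncard_le_one hdeg3 hw12 hac hw1 (by rwa [compl_compl])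
      rw [compl_compl] at h1
      exact ⟨_, by simp, by omega, hpc.isAcyclic_induce_compl_of_reachIn hac hr⟩
    · have := Set.ncard_insert_le u ((S \ {u, x1, x2, x3, v}) ∪ {w1, w2})
      exact ⟨_, by simp, by omega, hpc.isAcyclic_induce_compl_insert hac⟩
  · have hTcard := Set.ncard_union_le (S \ {u, x1, x2, x3, v}) {w1, w2}
    have hpair := Set.ncard_insert_le w1 {w2}
    rw [Set.ncard_singleton] at hpair
    have h1 := hpc.one_lt_ncard_compl_inter hdeg3 hac hw1 hw2
    rw [compl_compl] at h1
    by_cases hle : (S ∩ {u, x1, x2, x3, v}).ncard = 2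
    · have hSeq : S ∩ ({u, x1, x2, x3, v} ∪ {w1, w2}) = S ∩ {u, x1, x2, x3, v} := by
        rw [Set.inter_union_distrib_left, Set.union_eq_left]
        rintro y ⟨hy, rfl | rfl⟩
        exacts [(hw1 hy).elim, (hw2 hy).elim]
      have hr := hSQ (S ∩ ({u, x1, x2, x3, v} ∪ {w1, w2})) Set.inter_subset_right
      rw [Set.sdiff_inter_self_eq_sdiff, Set.sdiff_eq] at hr
      rcases hr (hac.induce_mono Set.inter_subset_right) with h | h | h | h
      · rw [hSeq] at h
        omega
      · exact ⟨_, by simp, by omega, hpc.isAcyclic_induce_compl_of_reachIn hac h⟩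
      · exact (hw1 h.1).elim
      · exact (hw2 h.1).elim
    · have := Set.ncard_insert_le u ((S \ {u, x1, x2, x3, v}) ∪ {w1, w2})
      exact ⟨_, by simp, by omega, hpc.isAcyclic_induce_compl_insert hac⟩
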